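/- arXiv:2301.10699 — 2 statements merged into one kernel-verified Lean document; each statement's English description precedes it below -/
import Mathlib

section
/- Let ([n],{Π_s}) be a satisfiable instance of quantum k-SAT, and let c ≥ 3 be a fixed natural number. Let p ∈ (0,1) and suppose n > Ψ(p,c) := max( ((2^c−1)(c−1)·ln 4)/ln(1/p) + (2^c−2) , e²·( 180(c−2)·2^{3(c−2)} / (√(2π)·(3 − 1/2^{c−2})) )² , 6·2^{c+1}·(c−1) ). Then the number of subsets C ∈ σ_c([n]) at which the instance is locally satisfiable by a product state is greater than p·C(n,c); equivalently, a uniformly random C ∈ σ_c([n]) is locally satisfiable by a product state with probability greater than p. -/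
open scoped Classical

namespace QkSAT

/-- The Hilbert space of the qubits indexed by the subset `C` of `[n]`,
with basis indexed by bit strings on `C`. -/
abbrev QVec (n : ℕ) (C : Finset (Fin n)) : Type := (↥C → Fin 2) → ℂ

/-- Extend an operator acting on the qubits in `s` to an operator on the qubits of `C ⊇ s`
which acts trivially on the qubits outside `s`. -/
noncomputable def extendOp {n : ℕ} (s C : Finset (Fin n))
    (K : Matrix (↥s → Fin 2) (↥s → Fin 2) ℂ) :
    Matrix (↥C → Fin 2) (↥C → Fin 2) ℂ :=
  Matrix.of fun f g =>
    if hs : s ⊆ C then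
      if ∀ i : ↥C, (i : Fin n) ∉ s → f i = g i then
        K (fun j => f ⟨j.1, hs j.2⟩) (fun j => g ⟨j.1, hs j.2⟩)
      else 0
    else 0

/-- An instance of quantum `k`-SAT on `n` qubits: for every `k`-element subset `s` of the
qubits, an orthogonal projection acting nontrivially only on the qubits in `s`, specified by
its matrix on the qubits in `s`. -/
structure Instance (n k : ℕ) where
  K : (s : Finset (Fin n)) → Matrix (↥s → Fin 2) (↥s → Fin 2) ℂ
  isHermitian : ∀ s : Finset (Fin n), s.card = k → (K s).IsHermitian
  isIdempotent : ∀ s : Finset (Fin n), s.card = k → K s * K s = K s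

/-- `∑_{s ∈ σ_k(C)} Π_s ψ` for a vector `ψ` on the qubits in `C`. -/
noncomputable def constraintSum {n k : ℕ} (I : Instance n k) (C : Finset (Fin n))
    (ψ : QVec n C) : QVec n C :=
  ∑ s ∈ Finset.powersetCard k C, (extendOp s C (I.K s)).mulVec ψ

/-- The restriction of the instance to the qubits in `C` is satisfiable. -/
def SatisfiableAt {n k : ℕ} (I : Instance n k) (C : Finset (Fin n)) : Prop :=
  ∃ ψ : QVec n C, ψ ≠ 0 ∧ constraintSum I C ψ = 0

/-- The instance is satisfiable. -/
def Satisfiable {n k : ℕ} (I : Instance n k) : Prop :=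
  SatisfiableAt I Finset.univ

/-- The product vector `⊗ᵢ φᵢ`. -/
def prodVec {ι : Type*} [Fintype ι] (φ : ι → (Fin 2 → ℂ)) : (ι → Fin 2) → ℂ :=
  fun f => ∏ i, φ i (f i)

/-- The instance is locally satisfiable by a product state at `C`. -/
def ProdSatisfiableAt {n k : ℕ} (I : Instance n k) (C : Finset (Fin n)) : Prop :=
  ∃ φ : ↥C → (Fin 2 → ℂ), (∀ i, φ i ≠ 0) ∧ constraintSum I C (prodVec φ) = 0

/-- The instance is `ε`-far from satisfiable by a product state: whenever removing the
constraints indexed by `Sig` admits a (nonzero) product-state solution, `|Sig| ≥ ε n^k`. -/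
def EpsFarFromProdSat {n k : ℕ} (I : Instance n k) (ε : ℝ) : Prop :=
  ∀ Sig : Finset (Finset (Fin n)),
    (∃ φ : ↥(Finset.univ : Finset (Fin n)) → (Fin 2 → ℂ), (∀ i, φ i ≠ 0) ∧
      ∑ s ∈ Finset.powersetCard k (Finset.univ : Finset (Fin n)) \ Sig,
        (extendOp s Finset.univ (I.K s)).mulVec (prodVec φ) = 0) →
    ε * (n : ℝ) ^ k ≤ (Sig.card : ℝ)


/-- The bound `Ψ(p,c)` from Theorem 1. -/
noncomputable def Psi (p : ℝ) (c : ℕ) : ℝ :=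
  max (max
      (((2 : ℝ) ^ c - 1) * ((c : ℝ) - 1) * Real.log 4 / Real.log (1 / p) + ((2 : ℝ) ^ c - 2))
      (Real.exp 1 ^ 2 *
        (180 * ((c : ℝ) - 2) * (2 : ℝ) ^ (3 * (c - 2)) /
          (Real.sqrt (2 * Real.pi) * (3 - 1 / (2 : ℝ) ^ (c - 2)))) ^ 2))
    (6 * (2 : ℝ) ^ (c + 1) * ((c : ℝ) - 1))

end QkSAT

namespace QkSAT

open Finset Matrix

section Pencil

variable {V W : Type*} [AddCommGroup V] [Module ℂ V] [FiniteDimensional ℂ V]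
  [AddCommGroup W] [Module ℂ W]

/-- A pencil of linear maps all of whose members have the same kernel and the same range
vanishes. -/
theorem pencil_eq_zero (Z₀ Z₁ : V →ₗ[ℂ] W)
    (hker : ∀ v, Z₀ v = 0 → Z₁ v = 0)
    (heig : ∀ v (c : ℂ), Z₁ v = c • Z₀ v → Z₀ v = 0)
    (hdual : ∀ ℓ : Module.Dual ℂ W, (∀ v, ℓ (Z₀ v) = 0) → ∀ v, ℓ (Z₁ v) = 0) :
    Z₀ = 0 ∧ Z₁ = 0 := by
  have hrange : ∀ v, ∃ u, Z₀ u = Z₁ v := by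
    intro v
    by_contra hv
    obtain ⟨ℓ, hℓ, hℓ'⟩ := Submodule.exists_dual_map_eq_bot_of_notMem
      (p := LinearMap.range Z₀) (x := Z₁ v) (by simpa using hv) inferInstance
    refine hℓ (hdual ℓ (fun u => ?_) v)
    have : ℓ (Z₀ u) ∈ (LinearMap.range Z₀).map ℓ :=
      Submodule.mem_map_of_mem (LinearMap.mem_range_self Z₀ u)
    rwa [hℓ', Submodule.mem_bot] at this
  obtain ⟨T, hT⟩ : ∃ T : V →ₗ[ℂ] V, Z₀ ∘ₗ T = Z₁ := by
    let b := Module.finBasis ℂ V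
    choose u hu using hrange
    refine ⟨b.constr ℂ (fun j => u (b j)), b.ext fun j => ?_⟩
    simp [hu]
  have hT' : ∀ v, Z₀ (T v) = Z₁ v := fun v => LinearMap.congr_fun hT v
  let N := LinearMap.ker Z₀
  have hN : N ≤ N.comap T := by
    intro v hv
    simpa [N, hT'] using hker v hv
  have htop : N = ⊤ := by
    by_contra hne
    have : Nontrivial (V ⧸ N) := Submodule.Quotient.nontrivial_iff.2 hne
    obtain ⟨μ, hμ⟩ := Module.End.exists_eigenvalue (N.mapQ N T hN)
    obtain ⟨q, hq⟩ := hμ.exists_hasEigenvector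
    obtain ⟨v, rfl⟩ := N.mkQ_surjective q
    have h := hq.apply_eq_smul
    rw [Submodule.mkQ_apply, Submodule.mapQ_apply, ← Submodule.Quotient.mk_smul,
      Submodule.Quotient.eq] at h
    have h0 : Z₀ v = 0 := heig v μ (by
      simpa [N, hT', sub_eq_zero] using h)
    exact hq.2 (by simpa [N] using h0)
  have h0 : Z₀ = 0 := LinearMap.ker_eq_top.1 htop
  exact ⟨h0, LinearMap.ext fun v => hker v (by simp [h0])⟩

end Pencil

section LocalSupport

variable {α : Type*} [DecidableEq α]

/-- The support of the reduced state of `ψ` on the qubits in `T`, as a space of functions of all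
bits that only depend on the bits in `T`. -/
noncomputable def localSupport (ψ : (α → Fin 2) → ℂ) (T : Finset α) :
    Submodule ℂ ((α → Fin 2) → ℂ) :=
  Submodule.span ℂ (Set.range fun h f => ψ (T.piecewise f h))

/-- No nonzero vector in the local support on `D ∪ S` is the product of a product vector on `D`
and a vector on `S`. -/
def NoProduct (ψ : (α → Fin 2) → ℂ) (D S : Finset α) : Prop :=
  ∀ (a : α → Fin 2 → ℂ) (z : (α → Fin 2) → ℂ), (∀ j, a j ≠ 0) → DependsOn z (S : Set α) →
    (fun f => (∏ j ∈ D, a j (f j)) * z f) ∈ localSupport ψ (D ∪ S) → z = 0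

/-- A vector in the local support that splits off a factor at `i` vanishes. -/
theorem NoProduct.eq_zero_of_factor {ψ : (α → Fin 2) → ℂ} {D S : Finset α} {i : α}
    (h : NoProduct ψ (insert i D) S) (hi : i ∉ D) {a : α → Fin 2 → ℂ} (ha : ∀ j, a j ≠ 0)
    {b : Fin 2 → ℂ} (hb : b ≠ 0) {ζ y : (α → Fin 2) → ℂ} (hy : DependsOn y (S : Set α))
    (hζ : ∀ f, ζ f = b (f i) * y f)
    (hmem : (fun f => (∏ j ∈ D, a j (f j)) * ζ f) ∈ localSupport ψ (insert i D ∪ S)) :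
    y = 0 := by
  refine h (Function.update a i b) y (fun j => ?_) hy ?_
  · by_cases hj : j = i
    · subst hj
      simpa using hb
    · simpa [hj] using ha j
  · convert hmem using 2 with f
    rw [prod_insert hi, Function.update_self, hζ]
    have : ∏ j ∈ D, Function.update a i b j (f j) = ∏ j ∈ D, a j (f j) :=
      prod_congr rfl fun j hj => by
        rw [Function.update_of_ne (ne_of_mem_of_not_mem hj hi)]
    rw [this]
    ring

theorem not_noProduct_empty {ψ : (α → Fin 2) → ℂ} (hψ : ψ ≠ 0) (S : Finset α) :
    ¬ NoProduct ψ ∅ S := by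
  intro h
  obtain ⟨f, hf⟩ := Function.ne_iff.1 hψ
  refine hf ?_
  have := h (fun _ => 1) (fun g => ψ (S.piecewise g f)) (fun _ => one_ne_zero) ?_ ?_
  · have h0 := congrFun this f
    rwa [piecewise_same] at h0
  · intro g g' hgg
    refine congrArg ψ (funext fun j => ?_)
    by_cases hj : j ∈ S
    · simp [hj, hgg j hj]
    · simp [hj]
  · simp only [prod_empty, one_mul, empty_union]
    exact Submodule.subset_span ⟨f, rfl⟩

variable [Fintype α]

/-- Contracting with a functional on the qubits in `S` maps local supports to local supports. -/
theorem contract_mem_localSupport {ψ v : (α → Fin 2) → ℂ} {T S : Finset α}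
    (hTS : Disjoint T S) (hv : v ∈ localSupport ψ (T ∪ S)) (χ : (α → Fin 2) → ℂ) :
    (fun f => ∑ g, χ g * v (S.piecewise g f)) ∈ localSupport ψ T := by
  unfold localSupport at hv
  induction hv using Submodule.span_induction with
  | mem v hv =>
    obtain ⟨h, rfl⟩ := hv
    have : (fun f => ∑ g, χ g * ψ ((T ∪ S).piecewise (S.piecewise g f) h)) =
        ∑ g, χ g • fun f => ψ (T.piecewise f (S.piecewise g h)) := by
      ext f
      simp only [Finset.sum_apply, Pi.smul_apply, smul_eq_mul]
      refine sum_congr rfl fun g _ => ?_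
      congr 2
      ext j
      have : j ∈ T → j ∉ S := fun h => Finset.disjoint_left.1 hTS h
      by_cases h1 : j ∈ T <;> by_cases h2 : j ∈ S <;> simp_all [Finset.piecewise]
    rw [this]
    exact Submodule.sum_mem _ fun g _ =>
      Submodule.smul_mem _ _ (Submodule.subset_span ⟨S.piecewise g h, rfl⟩)
  | zero =>
    convert Submodule.zero_mem (localSupport ψ T) using 1
    ext f
    simp
  | add v w _ _ hv hw =>
    convert Submodule.add_mem _ hv hw using 1
    ext f
    simp [mul_add, sum_add_distrib]
  | smul c v _ hv =>
    convert Submodule.smul_mem _ c hv using 1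
    ext f
    simp only [Pi.smul_apply, smul_eq_mul, mul_sum]
    exact sum_congr rfl fun g _ => by ring

/-- Contracting the second factor of a vector that is a product between `D` and
`S = {i} ∪ S₁ ∪ S₂` with a functional on `S₂`. -/
theorem contract_prod_mem_localSupport {ψ z : (α → Fin 2) → ℂ} {a : α → Fin 2 → ℂ}
    {D S S₁ S₂ : Finset α} {i : α} (hS : S = insert i (S₁ ∪ S₂))
    (hD : Disjoint D S₂) (hi : i ∉ S₂) (hS₁₂ : Disjoint S₁ S₂)
    (hmem : (fun f => (∏ j ∈ D, a j (f j)) * z f) ∈ localSupport ψ (D ∪ S))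
    (χ : (α → Fin 2) → ℂ) :
    (fun f => (∏ j ∈ D, a j (f j)) * ∑ g, χ g * z (S₂.piecewise g f)) ∈
      localSupport ψ (insert i D ∪ S₁) := by
  have hT : D ∪ S = (insert i D ∪ S₁) ∪ S₂ := by
    subst hS
    ext j
    simp only [mem_union, mem_insert]
    tauto
  rw [hT] at hmem
  have hdis : Disjoint (insert i D ∪ S₁) S₂ := by
    rw [disjoint_union_left, disjoint_insert_left]
    exact ⟨⟨hi, hD⟩, hS₁₂⟩
  convert contract_mem_localSupport hdis hmem χ using 2 with f
  rw [mul_sum]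
  refine sum_congr rfl fun g _ => ?_
  have : ∏ j ∈ D, a j (S₂.piecewise g f j) = ∏ j ∈ D, a j (f j) :=
    prod_congr rfl fun j hj => by
      rw [Finset.piecewise_eq_of_notMem _ _ _ (Finset.disjoint_left.1 hD hj)]
  rw [this]
  ring

/-- Gluing two disjoint systems along the qubit `i`. -/
theorem NoProduct.glue {ψ : (α → Fin 2) → ℂ} {D S₁ S₂ : Finset α} {i : α} (hi : i ∉ D)
    (hi₁ : i ∉ S₁) (hi₂ : i ∉ S₂) (hD₁ : Disjoint D S₁) (hD₂ : Disjoint D S₂)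
    (hS : Disjoint S₁ S₂) (h₁ : NoProduct ψ (insert i D) S₁)
    (h₂ : NoProduct ψ (insert i D) S₂) :
    NoProduct ψ D (insert i (S₁ ∪ S₂)) := by
  intro a z ha hz hmem
  have hm₁ := contract_prod_mem_localSupport rfl hD₂ hi₂ hS hmem
  have hm₂ := contract_prod_mem_localSupport (by rw [union_comm]) hD₁ hi₁ hS.symm hmem
  let Z (e : Fin 2) : ((α → Fin 2) → ℂ) →ₗ[ℂ] ((α → Fin 2) → ℂ) :=
    { toFun := fun χ f => ∑ g, χ g * z (S₂.piecewise g (Function.update f i e))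
      map_add' := fun χ χ' => by ext f; simp [add_mul, sum_add_distrib]
      map_smul' := fun c χ => by ext f; simp [mul_sum, mul_assoc] }
  have hZ : ∀ e χ f, Z e χ f = ∑ g, χ g * z (S₂.piecewise g (Function.update f i e)) :=
    fun _ _ _ => rfl
  have hdep : ∀ e χ, DependsOn (Z e χ) (S₁ : Set α) := by
    intro e χ f f' hff
    rw [hZ, hZ]
    refine sum_congr rfl fun g _ => congrArg _ (hz fun j hj => ?_)
    by_cases h2 : j ∈ S₂
    · simp [h2]
    · by_cases hji : j = i
      · subst hji
        simp [h2]
      · have : j ∈ S₁ := by simpa [hji, h2] using hj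
        simp [h2, hji, hff j this]
  have hself : ∀ χ f, ∑ g, χ g * z (S₂.piecewise g f) = Z (f i) χ f := by
    intro χ f
    rw [hZ, Function.update_eq_self]
  have hzero : Z 0 = 0 ∧ Z 1 = 0 := by
    refine pencil_eq_zero _ _ (fun χ h0 => ?_) (fun χ c hc => ?_) (fun ℓ h0 => ?_)
    · refine h₁.eq_zero_of_factor hi ha (b := ![0, 1]) (by simp) (hdep 1 χ) (fun f => ?_)
        (hm₁ χ)
      rw [hself]
      generalize f i = e
      fin_cases e <;> simp [h0]
    · refine h₁.eq_zero_of_factor hi ha (b := ![1, c]) (by simp) (hdep 0 χ) (fun f => ?_)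
        (hm₁ χ)
      rw [hself]
      generalize f i = e
      fin_cases e <;> simp [hc]
    · let l : (α → Fin 2) → ℂ := fun f => ℓ (Pi.single f 1)
      let y : Fin 2 → (α → Fin 2) → ℂ :=
        fun e g => ∑ f, l f * z (S₂.piecewise g (Function.update f i e))
      have hℓ : ∀ w, ℓ w = ∑ f, l f * w f := by
        intro w
        conv_lhs => rw [← Finset.univ_sum_single w]
        rw [map_sum]
        refine sum_congr rfl fun f _ => ?_
        have : (Pi.single f (w f) : (α → Fin 2) → ℂ) = w f • Pi.single f 1 := by
          rw [← Pi.single_smul]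
          simp
        rw [this, map_smul, smul_eq_mul, mul_comm]
      have hℓZ : ∀ e χ, ℓ (Z e χ) = ∑ g, χ g * y e g := by
        intro e χ
        simp only [hℓ, hZ, y, mul_sum]
        rw [sum_comm]
        exact sum_congr rfl fun g _ => sum_congr rfl fun f _ => by ring
      have hy0 : y 0 = 0 := by
        ext g
        have := h0 (Pi.single g 1)
        rw [hℓZ] at this
        simpa [Pi.single_apply] using this
      have hy1 : y 1 = 0 := by
        refine h₂.eq_zero_of_factor hi ha (b := ![0, 1]) (by simp) ?_ (fun g => ?_) (hm₂ l)
        · intro g g' hgg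
          refine sum_congr rfl fun f _ => congrArg _ (hz fun j _ => ?_)
          by_cases h2 : j ∈ S₂
          · simp [h2, hgg j h2]
          · simp [h2]
        · have : ∑ f, l f * z (S₁.piecewise f g) = y (g i) g := by
            refine sum_congr rfl fun f _ => congrArg _ (hz fun j hj => ?_)
            have : j ∈ S₁ → j ∉ S₂ := fun h => Finset.disjoint_left.1 hS h
            by_cases hji : j = i
            · subst hji
              simp [hi₁, hi₂]
            · by_cases h2 : j ∈ S₂
              · have h1 : j ∉ S₁ := fun h1 => this h1 h2
                simp [h1, h2]
              · have h1 : j ∈ S₁ := by simpa [hji, h2] using hj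
                simp [h1, h2, hji]
          rw [this]
          generalize g i = e
          fin_cases e <;> simp [hy0]
      intro χ
      rw [hℓZ, hy1]
      simp
  ext f
  have : Z (f i) (Pi.single f 1) f = z f := by
    rw [← hself]
    simp [Pi.single_apply, piecewise_same]
  rw [← this]
  generalize f i = e
  fin_cases e <;> simp [hzero]

end LocalSupport

section Rich

variable {α : Type*} [Fintype α] [DecidableEq α]

/-- `D` extends, in at least `K` ways at each of `r` successive steps, to a set
satisfying `P`. -/
def Rich (P : Finset α → Prop) (K : ℕ) : ℕ → Finset α → Prop
  | 0, D => P D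
  | r + 1, D => K ≤ #{i | i ∉ D ∧ Rich P K r (insert i D)}

theorem exists_noProduct_of_rich {ψ : (α → Fin 2) → ℂ} {P : Finset α → Prop}
    (hP : ∀ D, P D → NoProduct ψ D ∅) {K : ℕ} (r : ℕ) :
    ∀ D U : Finset α, Rich P K r D → #U + 2 ^ r ≤ K + 1 →
      ∃ S : Finset α, Disjoint D S ∧ Disjoint U S ∧ #S + 1 ≤ 2 ^ r ∧ NoProduct ψ D S := by
  induction r with
  | zero => exact fun D U h _ => ⟨∅, by simp, by simp, by simp, hP D h⟩
  | succ r ih =>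
    intro D U h hU
    have hpow : 1 ≤ 2 ^ r := Nat.one_le_two_pow
    rw [pow_succ] at hU
    obtain ⟨i, hi, hiU⟩ : ∃ i ∈ ({i | i ∉ D ∧ Rich P K r (insert i D)} : Finset α), i ∉ U :=
      exists_mem_notMem_of_card_lt_card (lt_of_lt_of_le (by omega) h)
    simp only [mem_filter, mem_univ, true_and] at hi
    obtain ⟨S₁, hD₁, hU₁, hc₁, h₁⟩ := ih (insert i D) U hi.2 (by omega)
    obtain ⟨S₂, hD₂, hU₂, hc₂, h₂⟩ := ih (insert i D) (U ∪ S₁) hi.2 (by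
      have := card_union_le U S₁
      omega)
    rw [disjoint_insert_left] at hD₁ hD₂
    rw [disjoint_union_left] at hU₂
    refine ⟨insert i (S₁ ∪ S₂), ?_, ?_, ?_,
      h₁.glue hi.1 hD₁.1 hD₂.1 hD₁.2 hD₂.2 hU₂.2 h₂⟩
    · rw [disjoint_insert_right, disjoint_union_right]
      exact ⟨hi.1, hD₁.2, hD₂.2⟩
    · rw [disjoint_insert_right, disjoint_union_right]
      exact ⟨hiU, hU₁, hU₂.1⟩
    · have h3 := card_insert_le i (S₁ ∪ S₂)
      have h4 := card_union_le S₁ S₂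
      rw [pow_succ]
      omega

theorem not_rich_singleton {ψ : (α → Fin 2) → ℂ} (hψ : ψ ≠ 0) {P : Finset α → Prop}
    (hP : ∀ D, P D → NoProduct ψ D ∅) {K r : ℕ} (hK : 2 ^ (r + 1) ≤ K + 2) (i : α) :
    ¬ Rich P K r {i} := by
  intro h
  rw [pow_succ] at hK
  have hpow : 1 ≤ 2 ^ r := Nat.one_le_two_pow
  obtain ⟨S₁, hD₁, -, hc₁, h₁⟩ := exists_noProduct_of_rich hP r {i} ∅ h (by simp; omega)
  obtain ⟨S₂, hD₂, hS, -, h₂⟩ := exists_noProduct_of_rich hP r {i} S₁ h (by omega)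
  rw [disjoint_singleton_left] at hD₁ hD₂
  rw [← insert_empty_eq] at h₁ h₂
  exact not_noProduct_empty hψ _
    (h₁.glue (by simp) hD₁ hD₂ (by simp) (by simp) hS h₂)

theorem card_filter_powersetCard_succ_le (P Q : Finset α → Prop) (m k : ℕ)
    (h : ∀ D : Finset α, ¬ Q D → #{i | i ∉ D ∧ P (insert i D)} ≤ k) :
    (m + 1) * #{D ∈ powersetCard (m + 1) (univ : Finset α) | P D} ≤
      (Fintype.card α - m) * #{D ∈ powersetCard m (univ : Finset α) | Q D} +
        k * (Fintype.card α).choose m := by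
  have h1 : #({D ∈ powersetCard (m + 1) (univ : Finset α) | P D}.sigma fun D => D) ≤
      #((powersetCard m (univ : Finset α)).sigma fun D =>
        ({i | i ∉ D ∧ P (insert i D)} : Finset α)) := by
    refine card_le_card_of_injOn (fun x => ⟨x.1.erase x.2, x.2⟩) ?_ ?_
    · rintro ⟨D, i⟩ hx
      simp only [coe_sigma, Set.mem_sigma_iff, mem_coe, mem_filter, mem_powersetCard_univ] at hx ⊢
      obtain ⟨⟨hD, hPD⟩, hi⟩ := hx
      simp [card_erase_of_mem hi, hD, insert_erase hi, hPD]
    · rintro ⟨D, i⟩ hx ⟨D', i'⟩ hx' heq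
      simp only [coe_sigma, Set.mem_sigma_iff, mem_coe] at hx hx'
      simp only [Sigma.mk.injEq, heq_eq_eq] at heq
      obtain ⟨heq, rfl⟩ := heq
      rw [← insert_erase hx.2, ← insert_erase hx'.2, heq]
  rw [card_sigma, card_sigma] at h1
  have h2 : ∑ D ∈ powersetCard (m + 1) (univ : Finset α) with P D, #D =
      (m + 1) * #{D ∈ powersetCard (m + 1) (univ : Finset α) | P D} := by
    rw [sum_const_nat (m := m + 1), mul_comm]
    intro D hD
    simpa using (mem_filter.1 hD).1
  rw [← h2]
  refine h1.trans ?_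
  rw [← sum_filter_add_sum_filter_not _ Q]
  refine Nat.add_le_add ?_ ?_
  · rw [mul_comm, ← smul_eq_mul]
    refine sum_le_card_nsmul _ _ _ fun D hD => ?_
    have hD' : #D = m := by simpa using (mem_filter.1 hD).1
    rw [← hD', ← card_compl]
    exact card_le_card fun i hi => by simpa using (mem_filter.1 hi).2.1
  · calc _ ≤ #{D ∈ powersetCard m (univ : Finset α) | ¬ Q D} • k :=
          sum_le_card_nsmul _ _ _ fun D hD => h D (mem_filter.1 hD).2
      _ ≤ k * (Fintype.card α).choose m := by
          rw [smul_eq_mul, mul_comm]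
          refine Nat.mul_le_mul_left _ ((card_filter_le _ _).trans ?_)
          simp

theorem card_rich_le (P : Finset α → Prop) (k c m : ℕ) (hc : m + 1 ≤ c)
    (hcn : c ≤ Fintype.card α) (h1 : ∀ i : α, ¬ Rich P (k + 1) (c - 1) {i}) :
    #{D ∈ powersetCard (m + 1) (univ : Finset α) | Rich P (k + 1) (c - (m + 1)) D} *
      (Fintype.card α - (c - 1)) ≤ m * k * (Fintype.card α).choose (m + 1) := by
  induction m with
  | zero =>
    have : {D ∈ powersetCard (0 + 1) (univ : Finset α) | Rich P (k + 1) (c - (0 + 1)) D} = ∅ := by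
      refine filter_eq_empty_iff.2 fun D hD => ?_
      obtain ⟨i, rfl⟩ := card_eq_one.1 (by simpa using hD)
      exact h1 i
    rw [this]
    simp
  | succ m ih =>
    have ih := ih (by omega)
    have hstep := card_filter_powersetCard_succ_le (Rich P (k + 1) (c - (m + 1 + 1)))
      (Rich P (k + 1) (c - (m + 1))) (m + 1) k (fun D hD => by
        rw [show c - (m + 1) = c - (m + 1 + 1) + 1 by omega, Rich] at hD
        omega)
    have hch := Nat.choose_succ_right_eq (Fintype.card α) (m + 1)
    have hN : Fintype.card α - (c - 1) ≤ Fintype.card α - (m + 1) := by omega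
    generalize Fintype.card α - (c - 1) = N at *
    generalize Fintype.card α - (m + 1) = M at *
    generalize #{D ∈ powersetCard (m + 1) (univ : Finset α) | Rich P (k + 1) (c - (m + 1)) D} = b
      at *
    generalize #{D ∈ powersetCard (m + 1 + 1) (univ : Finset α) |
      Rich P (k + 1) (c - (m + 1 + 1)) D} = b' at *
    generalize (Fintype.card α).choose (m + 1) = B at *
    generalize (Fintype.card α).choose (m + 1 + 1) = B' at *
    refine Nat.le_of_mul_le_mul_left (c := m + 1 + 1) ?_ (by omega)
    calc (m + 1 + 1) * (b' * N) = ((m + 1 + 1) * b') * N := by ring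
      _ ≤ (M * b + k * B) * N := Nat.mul_le_mul_right _ hstep
      _ = M * (b * N) + k * B * N := by ring
      _ ≤ M * (m * k * B) + k * B * M :=
        Nat.add_le_add (Nat.mul_le_mul_left _ ih) (Nat.mul_le_mul_left _ hN)
      _ = (m + 1) * k * (B * M) := by ring
      _ = (m + 1 + 1) * ((m + 1) * k * B') := by rw [← hch]; ring

end Rich

section Constraints

variable {n : ℕ} {s C : Finset (Fin n)}

/-- Overwrite the bits in `s`. -/
def overwrite (f : ↥C → Fin 2) (t : ↥s → Fin 2) : ↥C → Fin 2 :=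
  fun j => if h : j.1 ∈ s then t ⟨j.1, h⟩ else f j

theorem extendOp_mulVec_apply (hs : s ⊆ C) (K : Matrix (↥s → Fin 2) (↥s → Fin 2) ℂ)
    (v : QVec n C) (f : ↥C → Fin 2) :
    (extendOp s C K).mulVec v f =
      ∑ t, K (fun j => f ⟨j.1, hs j.2⟩) t * v (overwrite f t) := by
  rw [mulVec, dotProduct]
  symm
  refine sum_of_injOn (overwrite f) ?_ (by simp) ?_ ?_
  · intro t _ t' _ heq
    ext j
    have := congrFun heq ⟨j.1, hs j.2⟩
    simp only [overwrite, j.2, dite_true] at this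
    exact congrArg Fin.val this
  · intro g _ hg
    simp only [extendOp, of_apply, hs, dite_true]
    rw [if_neg, zero_mul]
    intro hfg
    refine hg ⟨fun j => g ⟨j.1, hs j.2⟩, by simp, ?_⟩
    ext j
    by_cases hj : j.1 ∈ s
    · simp [overwrite, hj]
    · simp [overwrite, hj, hfg j hj]
  · intro t _
    simp only [extendOp, of_apply, hs, dite_true]
    rw [if_pos]
    · congr 2
      ext j
      simp [overwrite]
    · intro j hj
      simp [overwrite, hj]

theorem extendOp_mulVec_mulVec (hs : s ⊆ C) {K : Matrix (↥s → Fin 2) (↥s → Fin 2) ℂ}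
    (hK : K * K = K) (v : QVec n C) :
    (extendOp s C K).mulVec ((extendOp s C K).mulVec v) = (extendOp s C K).mulVec v := by
  ext f
  have ho : ∀ t t' : ↥s → Fin 2, overwrite (overwrite f t) t' = overwrite f t' := by
    intro t t'
    ext j
    by_cases hj : j.1 ∈ s <;> simp [overwrite, hj]
  have hr : ∀ t : ↥s → Fin 2, (fun j : ↥s => overwrite f t ⟨j.1, hs j.2⟩) = t := by
    intro t
    ext j
    simp [overwrite]
  rw [extendOp_mulVec_apply hs, extendOp_mulVec_apply hs]
  simp only [extendOp_mulVec_apply hs, ho, hr, mul_sum]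
  rw [sum_comm]
  refine sum_congr rfl fun t' _ => ?_
  conv_rhs => rw [← hK, mul_apply, sum_mul]
  exact sum_congr rfl fun t _ => by ring

theorem extendOp_isHermitian {K : Matrix (↥s → Fin 2) (↥s → Fin 2) ℂ}
    (hK : K.IsHermitian) : (extendOp s C K).IsHermitian := by
  ext f g
  simp only [extendOp, conjTranspose_apply, of_apply]
  by_cases hs : s ⊆ C
  · have : (∀ i : ↥C, (i : Fin n) ∉ s → g i = f i) ↔ ∀ i : ↥C, (i : Fin n) ∉ s → f i = g i :=
      forall₂_congr fun _ _ => eq_comm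
    simp only [hs, dite_true, this]
    split_ifs
    · exact hK.apply _ _
    · simp
  · simp [hs]

/-- A state annihilated by a sum of projections is annihilated by each of them. -/
theorem extendOp_mulVec_eq_zero {k : ℕ} (I : Instance n k) {ψ : QVec n C}
    (h : constraintSum I C ψ = 0) (hs : s ∈ powersetCard k C) :
    (extendOp s C (I.K s)).mulVec ψ = 0 := by
  have hquad : ∀ s ∈ powersetCard k C, star ψ ⬝ᵥ (extendOp s C (I.K s)).mulVec ψ =
      star ((extendOp s C (I.K s)).mulVec ψ) ⬝ᵥ (extendOp s C (I.K s)).mulVec ψ := by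
    intro s hs
    rw [mem_powersetCard] at hs
    rw [star_mulVec, (extendOp_isHermitian (I.isHermitian s hs.2)).eq, ← dotProduct_mulVec,
      extendOp_mulVec_mulVec hs.1 (I.isIdempotent s hs.2)]
  have hsum : ∑ s ∈ powersetCard k C,
      star ((extendOp s C (I.K s)).mulVec ψ) ⬝ᵥ (extendOp s C (I.K s)).mulVec ψ = 0 := by
    rw [← sum_congr rfl hquad, ← dotProduct_sum]
    exact (congrArg _ h).trans (dotProduct_zero _)
  open scoped ComplexOrder in
  exact dotProduct_star_self_eq_zero.1
    ((sum_eq_zero_iff_of_nonneg fun s _ => dotProduct_star_self_nonneg _).1 hsum s hs)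

/-- The restriction of the instance to `C` is satisfied by the local support on `C`. -/
theorem constraintSum_eq_zero_of_mem_localSupport {k : ℕ} (I : Instance n k)
    {ψ : QVec n univ} (hψ : constraintSum I univ ψ = 0) {v : (Fin n → Fin 2) → ℂ}
    (hv : v ∈ localSupport (fun f : Fin n → Fin 2 => ψ fun j => f j) C) :
    constraintSum I C (fun f => v fun j => if h : j ∈ C then f ⟨j, h⟩ else 0) = 0 := by
  refine sum_eq_zero fun s hs => ?_
  have hsC := (mem_powersetCard.1 hs).1
  have hsu : s ∈ powersetCard k univ :=
    mem_powersetCard.2 ⟨subset_univ s, (mem_powersetCard.1 hs).2⟩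
  unfold localSupport at hv
  induction hv using Submodule.span_induction with
  | mem v hv =>
    obtain ⟨h, rfl⟩ := hv
    ext f
    rw [extendOp_mulVec_apply hsC]
    have := congrFun (extendOp_mulVec_eq_zero I hψ hsu)
      (fun j => if hj : j.1 ∈ C then f ⟨j, hj⟩ else h j)
    rw [extendOp_mulVec_apply (subset_univ s)] at this
    refine Eq.trans (sum_congr rfl fun t _ => ?_) this
    congr 1
    · congr 1
      ext j
      simp [hsC j.2]
    · refine congrArg ψ (funext fun j => ?_)
      by_cases hj : j.1 ∈ C
      · by_cases hj' : j.1 ∈ s <;> simp [overwrite, hj, hj']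
      · have hj' : j.1 ∉ s := fun h => hj (hsC h)
        simp [overwrite, hj, hj']
  | zero => exact mulVec_zero _
  | add v w _ _ hv hw => exact (mulVec_add _ _ _).trans (by rw [hv, hw, add_zero])
  | smul c v _ hv => exact (mulVec_smul _ c _).trans (by rw [hv, smul_zero])

theorem noProduct_of_not_prodSatisfiableAt {k : ℕ} (I : Instance n k)
    {ψ : QVec n univ} (hψ : constraintSum I univ ψ = 0) (hC : ¬ ProdSatisfiableAt I C) :
    NoProduct (fun f : Fin n → Fin 2 => ψ fun j => f j) C ∅ := by
  intro a z ha hz hmem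
  by_contra hz0
  obtain ⟨f₀, hf₀⟩ := Function.ne_iff.1 hz0
  have hconst : ∀ f, z f = z f₀ := fun f => hz (by simp)
  refine hC ⟨fun j => a j, fun j => ha j, ?_⟩
  have hmem' : (fun f => ∏ j ∈ C, a j (f j)) ∈ localSupport (fun f : Fin n → Fin 2 => ψ fun j => f j) C := by
    rw [union_empty] at hmem
    convert Submodule.smul_mem _ (z f₀)⁻¹ hmem using 1
    ext f
    rw [Pi.smul_apply, hconst f, smul_eq_mul]
    field_simp [show z f₀ ≠ 0 from hf₀]
  convert constraintSum_eq_zero_of_mem_localSupport I hψ hmem' using 2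
  ext f
  rw [prodVec, ← prod_coe_sort C]
  exact prod_congr rfl fun j _ => by simp

end Constraints

section Bound

theorem exp_neg_log_four_mul_le {y : ℝ} (hy0 : 0 ≤ y) (hy : y ≤ 1 / 2) :
    Real.exp (-(Real.log 4 * y)) ≤ 1 - y := by
  have h := convexOn_exp.2 (Set.mem_univ (-Real.log 2)) (Set.mem_univ 0)
    (show 0 ≤ 2 * y by linarith) (show 0 ≤ 1 - 2 * y by linarith) (by ring)
  have hlog : Real.log 4 = 2 * Real.log 2 := by
    rw [show (4 : ℝ) = 2 ^ 2 by norm_num, Real.log_pow]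
    norm_num
  simp only [smul_eq_mul, mul_zero, add_zero, Real.exp_zero, mul_one, Real.exp_neg,
    Real.exp_log two_pos] at h
  rw [hlog, show -(2 * Real.log 2 * y) = 2 * y * -Real.log 2 by ring]
  linarith

theorem lt_one_sub_of_Psi_lt {n c : ℕ} {p : ℝ} (hc : 3 ≤ c) (hp0 : 0 < p) (hp1 : p < 1)
    (hn : Psi p c < (n : ℝ)) :
    c ≤ n ∧ p < 1 - ((c : ℝ) - 1) * ((2 : ℝ) ^ c - 2) / ((n : ℝ) - (c - 1)) := by
  obtain ⟨h12, h3⟩ := max_lt_iff.1 hn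
  have h1 := (max_lt_iff.1 h12).1
  have hcR : (3 : ℝ) ≤ c := by exact_mod_cast hc
  have hcpow : (c : ℝ) + 1 ≤ 2 ^ c := by exact_mod_cast Nat.lt_two_pow_self (n := c)
  rw [pow_succ] at h3
  generalize (2 : ℝ) ^ c = q at *
  have hbig : 24 * q < n := by nlinarith
  have hcn : (c : ℝ) ≤ n := by linarith
  refine ⟨by exact_mod_cast hcn, ?_⟩
  have hL : 0 < Real.log (1 / p) := Real.log_pos (by rw [lt_div_iff₀ hp0]; linarith)
  have hlog4 : 0 < Real.log 4 := Real.log_pos (by norm_num)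
  set y := ((c : ℝ) - 1) * (q - 2) / ((n : ℝ) - (c - 1)) with hy
  have hden : 0 < (n : ℝ) - (c - 1) := by linarith
  have hy0 : 0 ≤ y := div_nonneg (mul_nonneg (by linarith) (by linarith)) hden.le
  have hy2 : y ≤ 1 / 2 := by
    rw [hy, div_le_iff₀ hden]
    nlinarith
  refine lt_of_lt_of_le ?_ (exp_neg_log_four_mul_le hy0 hy2)
  have hden' : 0 < (n : ℝ) - (q - 2) := by linarith
  have hyT : y ≤ (q - 1) * (c - 1) / ((n : ℝ) - (q - 2)) := by
    rw [hy, mul_comm]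
    refine div_le_div₀ (mul_nonneg (by linarith) (by linarith)) ?_ hden' (by linarith)
    exact mul_le_mul_of_nonneg_right (by linarith) (by linarith)
  have hlt : (q - 1) * (c - 1) * Real.log 4 / ((n : ℝ) - (q - 2)) < Real.log (1 / p) := by
    rw [div_lt_iff₀ hden', mul_comm (Real.log _), ← div_lt_iff₀ hL]
    linarith
  rw [← Real.log_lt_iff_lt_exp hp0]
  have : Real.log 4 * y ≤ (q - 1) * (c - 1) * Real.log 4 / ((n : ℝ) - (q - 2)) := by
    calc _ ≤ Real.log 4 * ((q - 1) * (c - 1) / ((n : ℝ) - (q - 2))) :=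
          mul_le_mul_of_nonneg_left hyT hlog4.le
      _ = _ := by ring
  rw [one_div, Real.log_inv] at hlt
  linarith

end Bound

/-- **Theorem 1 (local satisfiability), instance form.**
If the quantum `k`-SAT instance `I` on `n` qubits is satisfiable, `c ≥ 3`, `p ∈ (0,1)` and
`n > Ψ(p,c)`, then the number of `c`-element subsets `C` of the qubits at which `I` is
locally satisfiable by a product state is greater than `p · C(n,c)`; equivalently, a
uniformly random `C ∈ σ_c([n])` is locally satisfiable by a product state with probability
greater than `p`. -/
theorem locally_prod_satisfiable_of_satisfiable
    (n k c : ℕ) (p : ℝ) (I : Instance n k) (hsat : Satisfiable I)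
    (hc : 3 ≤ c) (hp0 : 0 < p) (hp1 : p < 1) (hn : Psi p c < (n : ℝ)) :
    p * (n.choose c : ℝ) <
      (((Finset.powersetCard c (Finset.univ : Finset (Fin n))).filter
        (fun C => ProdSatisfiableAt I C)).card : ℝ) := by
  obtain ⟨hcn, hp⟩ := lt_one_sub_of_Psi_lt hc hp0 hp1 hn
  obtain ⟨ψ, hψ0, hψ⟩ := hsat
  have hψ0' : (fun f : Fin n → Fin 2 => ψ fun j => f j) ≠ 0 := by
    obtain ⟨f, hf⟩ := Function.ne_iff.1 hψ0
    exact Function.ne_iff.2 ⟨fun j => f ⟨j, mem_univ j⟩, hf⟩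
  have hpow : 8 ≤ 2 ^ c := (Nat.pow_le_pow_right two_pos hc : 2 ^ 3 ≤ 2 ^ c)
  have hcount := card_rich_le (fun D => ¬ ProdSatisfiableAt I D) (2 ^ c - 2) c (c - 1)
    (by omega) (by simpa using hcn) (fun i => not_rich_singleton hψ0'
      (fun D hD => noProduct_of_not_prodSatisfiableAt I hψ hD)
      (by rw [show c - 1 + 1 = c by omega]; omega) i)
  rw [show c - 1 + 1 = c by omega, Nat.sub_self, Fintype.card_fin] at hcount
  replace hcount : #{C ∈ powersetCard c (univ : Finset (Fin n)) | ¬ ProdSatisfiableAt I C} *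
      (n - (c - 1)) ≤ (c - 1) * (2 ^ c - 2) * n.choose c := by
    convert hcount
  have hsplit := card_filter_add_card_filter_not (s := powersetCard c (univ : Finset (Fin n)))
    (fun C => ProdSatisfiableAt I C)
  rw [card_powersetCard, card_univ, Fintype.card_fin] at hsplit
  have hch : 0 < (n.choose c : ℝ) := by exact_mod_cast Nat.choose_pos hcn
  generalize #{C ∈ powersetCard c (univ : Finset (Fin n)) | ProdSatisfiableAt I C} = good at *
  generalize #{C ∈ powersetCard c (univ : Finset (Fin n)) | ¬ ProdSatisfiableAt I C} = bad at *
  have hcount' : (bad : ℝ) * ((n : ℝ) - (c - 1)) ≤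
      ((c : ℝ) - 1) * ((2 : ℝ) ^ c - 2) * n.choose c := by
    have := (Nat.cast_le (α := ℝ)).2 hcount
    push_cast [Nat.cast_sub (show c - 1 ≤ n by omega), Nat.cast_sub (show 1 ≤ c by omega),
      Nat.cast_sub (show 2 ≤ 2 ^ c by omega)] at this
    exact this
  have hden : 0 < (n : ℝ) - (c - 1) := by
    have : (c : ℝ) ≤ n := by exact_mod_cast hcn
    linarith
  have hsplit' : (good : ℝ) + bad = n.choose c := by exact_mod_cast hsplit
  have hbad : (bad : ℝ) ≤
      ((c : ℝ) - 1) * ((2 : ℝ) ^ c - 2) / ((n : ℝ) - (c - 1)) * n.choose c := by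
    rw [div_mul_eq_mul_div, le_div_iff₀ hden]
    exact hcount'
  have := mul_lt_mul_of_pos_right hp hch
  linarith

end QkSAT
end

section
/- Let c ≥ 3 be a fixed natural number, let p ∈ (0,1), and suppose n > Ψ(p,c) := max( ((2^c−1)(c−1)·ln 4)/ln(1/p) + (2^c−2) , e²·( 180(c−2)·2^{3(c−2)} / (√(2π)·(3 − 1/2^{c−2})) )² , 6·2^{c+1}·(c−1) ). Then for any state |ψ⟩ ∈ (ℂ²)^{⊗n}, the number of subsets C ∈ σ_c([n]) for which the subspace supp(Tr_{C̄}(|ψ⟩⟨ψ|)) ⊆ (ℂ²)^{⊗c} contains a nonzero product vector |φ₁⟩⊗…⊗|φ_c⟩ is greater than p·C(n,c). -/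
open scoped Classical

namespace QkSAT

/-- Combine a bit string on the qubits in `C` with a bit string on the qubits outside `C`
into a bit string on all `n` qubits. -/
def merge {n : ℕ} (C : Finset (Fin n)) (f : ↥C → Fin 2) (g : ↥Cᶜ → Fin 2) : Fin n → Fin 2 :=
  fun i => if h : i ∈ C then f ⟨i, h⟩ else g ⟨i, Finset.mem_compl.mpr h⟩

/-- The support of the reduced density matrix of `ψ` on the qubits in `C` (tracing out the
qubits outside `C`): the span of the contractions of `ψ` against the basis vectors on the
qubits outside `C`, i.e. `span{(⟨v|⊗1_C)|ψ⟩ : v}`. -/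
noncomputable def reducedSupp {n : ℕ} (C : Finset (Fin n)) (ψ : (Fin n → Fin 2) → ℂ) :
    Submodule ℂ (QVec n C) :=
  Submodule.span ℂ {w | ∃ g : ↥Cᶜ → Fin 2, w = fun f => ψ (merge C f g)}

/-- The subspace `W` of the Hilbert space of the qubits in `C` contains a nonzero product
vector `|φ₁⟩⊗…⊗|φ_c⟩`. -/
def ContainsProdVec {n : ℕ} (C : Finset (Fin n)) (W : Submodule ℂ (QVec n C)) : Prop :=
  ∃ φ : ↥C → (Fin 2 → ℂ), (∀ i, φ i ≠ 0) ∧ prodVec φ ∈ W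


end QkSAT

namespace QkSAT


/-- The span of the slices of `ψ` obtained by fixing the qubits outside `C`, regarded as functions
of all the qubits. -/
def sliceSpan {ι : Type*} [DecidableEq ι] (C : Finset ι) (ψ : (ι → Fin 2) → ℂ) :
    Submodule ℂ ((ι → Fin 2) → ℂ) :=
  Submodule.span ℂ (Set.range fun (g f : ι → Fin 2) => ψ (C.piecewise f g))

/-- The reduced support of `ψ` on `C` contains a nonzero product vector. -/
def HasProduct {ι : Type*} [DecidableEq ι] (C : Finset ι) (ψ : (ι → Fin 2) → ℂ) : Prop :=
  ∃ φ : ι → Fin 2 → ℂ, (∀ i, φ i ≠ 0) ∧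
    (fun f : ι → Fin 2 => ∏ i ∈ C, φ i (f i)) ∈ sliceSpan C ψ

/-- The reduced support of `ψ` on `insert i S` contains the product of the vector `u` on the
qubit `i` and the vector `y` on the remaining qubits. -/
def SplitsAs {ι : Type*} [DecidableEq ι] (i : ι) (S : Finset ι) (ψ y : (ι → Fin 2) → ℂ) : Prop :=
  ∃ u : Fin 2 → ℂ, u ≠ 0 ∧ (∀ f x, y (Function.update f i x) = y f) ∧
    (fun f => u (f i) * y f) ∈ sliceSpan (insert i S) ψ

theorem slice_mem_sliceSpan {ι : Type*} [DecidableEq ι] (C : Finset ι) (ψ : (ι → Fin 2) → ℂ)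
    (g : ι → Fin 2) : (fun f => ψ (C.piecewise f g)) ∈ sliceSpan C ψ :=
  Submodule.subset_span ⟨g, rfl⟩

theorem hasProduct_empty {ι : Type*} [DecidableEq ι] {y : (ι → Fin 2) → ℂ} (hy : y ≠ 0) :
    HasProduct ∅ y := by
  obtain ⟨g, hg⟩ := Function.ne_iff.mp hy
  refine ⟨fun _ _ => 1, fun i h => one_ne_zero (congrFun h 0), ?_⟩
  convert (sliceSpan ∅ y).smul_mem (y g)⁻¹ (slice_mem_sliceSpan ∅ y g) using 1
  funext f
  simpa using (inv_mul_cancel₀ hg).symm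

theorem SplitsAs.hasProduct_insert {ι : Type*} [DecidableEq ι] {i : ι} {S D : Finset ι}
    {ψ y : (ι → Fin 2) → ℂ} (h : SplitsAs i S ψ y) (hi : i ∉ S) (hD : D ⊆ S)
    (hy : HasProduct D y) : HasProduct (insert i D) ψ := by
  obtain ⟨u, hu, hyi, hmem⟩ := h
  obtain ⟨φ, hφ, hprod⟩ := hy
  have hiD : i ∉ D := fun h => hi (hD h)
  refine ⟨Function.update φ i u, fun j => ?_, ?_⟩
  · rcases eq_or_ne j i with rfl | hj
    · simpa using hu
    · simpa [hj] using hφ j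
  let mulU : ((ι → Fin 2) → ℂ) →ₗ[ℂ] ((ι → Fin 2) → ℂ) :=
    LinearMap.mulLeft ℂ (fun f : ι → Fin 2 => u (f i))
  have hle : (sliceSpan D y).map mulU ≤ sliceSpan (insert i D) ψ := by
    rw [sliceSpan, Submodule.map_span_le]
    rintro _ ⟨g, rfl⟩
    let pull : ((ι → Fin 2) → ℂ) →ₗ[ℂ] ((ι → Fin 2) → ℂ) :=
      LinearMap.funLeft ℂ ℂ fun f : ι → Fin 2 => (insert i D).piecewise f g
    have hpull : (sliceSpan (insert i S) ψ).map pull ≤ sliceSpan (insert i D) ψ := by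
      rw [sliceSpan, Submodule.map_span_le]
      rintro _ ⟨g', rfl⟩
      convert slice_mem_sliceSpan (insert i D) ψ ((insert i S).piecewise g g') using 1
      funext f
      change ψ _ = ψ _
      congr 1
      funext j
      have := @hD j
      by_cases h1 : j ∈ D <;> by_cases h2 : j ∈ S <;> by_cases h3 : j = i <;>
        simp_all [Finset.piecewise]
    convert hpull (Submodule.mem_map_of_mem hmem) using 1
    funext f
    change u (f i) * y _ = u _ * y _
    congr 1
    · simp [Finset.piecewise]
    · rw [← hyi _ (f i)]
      congr 1
      funext j
      by_cases h3 : j = i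
      · subst h3; simp [Finset.piecewise]
      · simp [Finset.piecewise, h3]
  convert hle (Submodule.mem_map_of_mem hprod) using 1
  funext f
  change _ = u (f i) * _
  rw [Finset.prod_insert hiD, Function.update_self]
  congr 1
  refine Finset.prod_congr rfl fun j hj => ?_
  have hji : j ≠ i := by
    rintro rfl
    exact hiD hj
  rw [Function.update_of_ne hji]

/-- A pencil of linear maps over `ℂ` either has an eigenvector or a functional which annihilates
the first map but not the second. -/
theorem exists_eigenvector_or_functional {X Y : Type*} [AddCommGroup X] [Module ℂ X]
    [AddCommGroup Y] [Module ℂ Y] [FiniteDimensional ℂ Y] (T₀ T₁ : X →ₗ[ℂ] Y)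
    (h : T₀ ≠ 0 ∨ T₁ ≠ 0) :
    (∃ (v : X) (a : ℂ), T₀ v ≠ 0 ∧ T₁ v = a • T₀ v) ∨
      ∃ F : Y →ₗ[ℂ] ℂ, (∀ v, F (T₀ v) = 0) ∧ ∃ v, F (T₁ v) ≠ 0 := by
  by_cases hr : ∀ v, T₁ v ∈ LinearMap.range T₀
  · left
    have hT : T₀ ≠ 0 := by
      rintro rfl
      rcases h with h | h
      · exact h rfl
      · exact h (LinearMap.ext fun v => by simpa using hr v)
    obtain ⟨s, hs⟩ := T₀.rangeRestrict.exists_rightInverse_of_surjective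
      (LinearMap.range_rangeRestrict T₀)
    have : Nontrivial (LinearMap.range T₀) := by
      rw [Submodule.nontrivial_iff_ne_bot]
      exact fun h => hT (LinearMap.range_eq_bot.mp h)
    obtain ⟨a, ha⟩ := Module.End.exists_eigenvalue ((T₁.codRestrict (LinearMap.range T₀) hr) ∘ₗ s)
    obtain ⟨y, hy⟩ := ha.exists_hasEigenvector
    have h0 : T₀ (s y) = y := congrArg Subtype.val (LinearMap.congr_fun hs y)
    refine ⟨s y, a, ?_, ?_⟩
    · rw [h0]
      exact fun h => hy.2 (Subtype.ext h)
    · rw [h0]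
      exact congrArg Subtype.val hy.apply_eq_smul
  · right
    push Not at hr
    obtain ⟨v, hv⟩ := hr
    obtain ⟨F, hF, hF'⟩ := Submodule.exists_le_ker_of_notMem hv
    exact ⟨F, fun w => hF' ⟨w, rfl⟩, v, hF⟩

/-- No-cloning: the qubit `i` cannot be inseparable from both of two disjoint sets of qubits. -/
theorem exists_splitsAs_of_disjoint {ι : Type*} [DecidableEq ι] [Fintype ι]
    {ψ : (ι → Fin 2) → ℂ} (hψ : ψ ≠ 0) {i : ι} {S S' : Finset ι} (hi : i ∉ S) (hi' : i ∉ S')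
    (hS : Disjoint S S') :
    (∃ y, y ≠ 0 ∧ SplitsAs i S ψ y) ∨ ∃ y, y ≠ 0 ∧ SplitsAs i S' ψ y := by
  let T (x : Fin 2) : ((ι → Fin 2) → ℂ) →ₗ[ℂ] ((ι → Fin 2) → ℂ) :=
    ∑ g, (LinearMap.proj g).smulRight
      (fun f : ι → Fin 2 => ψ (Function.update (S.piecewise f g) i x))
  have hT (x : Fin 2) (v : (ι → Fin 2) → ℂ) (f : ι → Fin 2) :
      T x v f = ∑ g, v g * ψ (Function.update (S.piecewise f g) i x) := by
    simp [T]
  have hTsingle (x : Fin 2) (g : ι → Fin 2) :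
      T x (Pi.single g 1) = fun f => ψ (Function.update (S.piecewise f g) i x) := by
    funext f
    simp [hT, Pi.single_apply]
  have hne : T 0 ≠ 0 ∨ T 1 ≠ 0 := by
    by_contra! h
    refine hψ (funext fun g => ?_)
    have hx : T (g i) = 0 := by
      rcases Fin.exists_fin_two.mp ⟨g i, rfl⟩ with hg | hg
      · rw [hg]; exact h.1
      · rw [hg]; exact h.2
    have := congrFun (hTsingle (g i) g) g
    rw [hx] at this
    simpa [Finset.piecewise_same] using this.symm
  have hup (g : ι → Fin 2) (j : ι) (hj : j ∉ S) (x : Fin 2) (f : ι → Fin 2) :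
      S.piecewise (Function.update f j x) g = S.piecewise f g := by
    funext l
    by_cases hl : l ∈ S
    · have : l ≠ j := fun h => hj (h ▸ hl)
      simp [hl, this]
    · simp [hl]
  rcases exists_eigenvector_or_functional (T 0) (T 1) hne with ⟨v, a, h0, h1⟩ | ⟨F, hF, v, hv⟩
  · left
    refine ⟨T 0 v, h0, ![1, a], fun h => one_ne_zero (congrFun h 0), fun f x => ?_, ?_⟩
    · simp only [hT, hup _ i hi]
    · have : (fun f => (![1, a] : Fin 2 → ℂ) (f i) * T 0 v f) =
          ∑ g, v g • fun f => ψ ((insert i S).piecewise f g) := by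
        funext f
        have hf : (![1, a] : Fin 2 → ℂ) (f i) * T 0 v f = T (f i) v f := by
          generalize f i = x
          fin_cases x
          · simp
          · simpa using (congrFun h1 f).symm
        rw [hf, hT, Finset.sum_apply]
        simp [Finset.piecewise_insert]
      rw [this]
      exact Submodule.sum_mem _ fun g _ => Submodule.smul_mem _ _ (slice_mem_sliceSpan _ ψ g)
  · right
    have hFsum (w : (ι → Fin 2) → ℂ) : F w = ∑ f, w f * F (Pi.single f 1) := by
      conv_lhs => rw [pi_eq_sum_univ' w]
      simp
    obtain ⟨g₀, hg₀⟩ : ∃ g₀, F (T 1 (Pi.single g₀ 1)) ≠ 0 := by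
      by_contra! h
      refine hv ?_
      rw [pi_eq_sum_univ' v]
      simp [h]
    refine ⟨fun f => F (T 1 (Pi.single (S'.piecewise f g₀) 1)), fun h => hg₀ ?_, ![0, 1],
      fun h => one_ne_zero (congrFun h 1), fun f x => ?_, ?_⟩
    · simpa [Finset.piecewise_same] using congrFun h g₀
    · have : S'.piecewise (Function.update f i x) g₀ = S'.piecewise f g₀ := by
        funext l
        by_cases hl : l ∈ S'
        · have : l ≠ i := fun h => hi' (h ▸ hl)
          simp [hl, this]
        · simp [hl]
      simp only [this]
    · have : (fun f => (![0, 1] : Fin 2 → ℂ) (f i) * F (T 1 (Pi.single (S'.piecewise f g₀) 1))) =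
          ∑ f', F (Pi.single f' 1) •
            fun f => ψ ((insert i S').piecewise f (S.piecewise f' g₀)) := by
        funext f
        have hf : (![0, 1] : Fin 2 → ℂ) (f i) * F (T 1 (Pi.single (S'.piecewise f g₀) 1)) =
            F (T (f i) (Pi.single (S'.piecewise f g₀) 1)) := by
          generalize f i = x
          fin_cases x
          · simp [hF]
          · simp
        rw [hf, hFsum, Finset.sum_apply]
        refine Finset.sum_congr rfl fun f' _ => ?_
        rw [hTsingle, mul_comm, Pi.smul_apply, smul_eq_mul]
        congr 1
        change ψ _ = ψ _
        congr 1
        funext l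
        by_cases h1 : l = i
        · subst h1; simp
        · by_cases h2 : l ∈ S
          · simp [Finset.piecewise, h1, h2, Finset.disjoint_left.mp hS h2]
          · simp [Finset.piecewise, h1, h2]
      rw [this]
      exact Submodule.sum_mem _ fun g _ => Submodule.smul_mem _ _ (slice_mem_sliceSpan _ ψ _)

theorem exists_perm_map_eq {α : Type*} [Fintype α] {D D' : Finset α}
    (h : D.card = D'.card) : ∃ π : Equiv.Perm α, D.map π.toEmbedding = D' := by
  let e : {x // x ∈ D} ≃ {x // x ∈ D'} := Finset.equivOfCardEq h
  refine ⟨e.extendSubtype, Finset.eq_of_subset_of_card_le (fun x hx => ?_) (by simp [h])⟩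
  obtain ⟨y, hy, rfl⟩ := Finset.mem_map.mp hx
  exact e.extendSubtype_mem y hy

/-- The sum over all sets of a given size of a permutation-invariant function. -/
theorem sum_powersetCard_eq_of_perm_invariant {α : Type*} [Fintype α] {f : Finset α → ℝ}
    (hf : ∀ (π : Equiv.Perm α) (D : Finset α), f (D.map π.toEmbedding) = f D) {b : Finset (Finset α)}
    (B : Finset α) (hb : ∀ D ∈ b, D.card = B.card) :
    ∑ D ∈ b, f D = b.card * f B := by
  rw [Finset.sum_congr rfl fun D hD => ?_, Finset.sum_const, nsmul_eq_mul]
  obtain ⟨π, rfl⟩ := exists_perm_map_eq (hb D hD)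
  exact (hf π D).symm

/-- The indicator that the image of `F` under `e` belongs to `b`. -/
noncomputable def hit {X α : Type*} (b : Finset (Finset α)) (e : X ↪ α) (F : Finset X) : ℝ :=
  if F.map e ∈ b then 1 else 0

/-- The probability that a random embedding sends `F` into `b` is the density of `b`. -/
theorem sum_hit_mul_choose {X α : Type*} [Fintype X] [Fintype α] {b : Finset (Finset α)}
    (F : Finset X) (hb : ∀ D ∈ b, D.card = F.card) :
    (∑ e : X ↪ α, hit b e F) * (Fintype.card α).choose F.card =
      b.card * Fintype.card (X ↪ α) := by
  rcases isEmpty_or_nonempty (X ↪ α) with hE | ⟨⟨e₀⟩⟩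
  · simp
  let f (D : Finset α) : ℝ := ∑ e : X ↪ α, if F.map e = D then 1 else 0
  have hf (π : Equiv.Perm α) (D : Finset α) : f (D.map π.toEmbedding) = f D := by
    change ∑ e : X ↪ α, _ = _
    rw [← Equiv.sum_comp (Equiv.embeddingCongr (Equiv.refl X) π)]
    refine Finset.sum_congr rfl fun e _ => ?_
    have : F.map (Equiv.embeddingCongr (Equiv.refl X) π e) = (F.map e).map π.toEmbedding := by
      rw [Finset.map_map]
      congr 1
    simp only [this, Finset.map_inj]
  have hsum (b' : Finset (Finset α)) : ∑ D ∈ b', f D = ∑ e : X ↪ α, hit b' e F := by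
    rw [Finset.sum_comm]
    simp [hit]
  have h1 := sum_powersetCard_eq_of_perm_invariant hf (b := b) (F.map e₀) (by simpa using hb)
  have h2 := sum_powersetCard_eq_of_perm_invariant hf
    (b := Finset.powersetCard F.card Finset.univ) (F.map e₀) (by simp)
  rw [hsum] at h1 h2
  have h3 : ∑ e : X ↪ α, hit (Finset.powersetCard F.card Finset.univ) e F =
      Fintype.card (X ↪ α) := by
    simp [hit]
  rw [h3, Finset.card_powersetCard, Finset.card_univ] at h2
  rw [h1, h2]
  ring

/-- The block `{j} × univ`. -/
def block {k d : ℕ} (j : Fin k) : Finset (Fin k × Fin d) := {j} ×ˢ Finset.univ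

/-- One of the two halves of an embedding of `Bool × Y`. -/
def half {Y α : Type*} (e : Bool × Y ↪ α) (x : Bool) : Y ↪ α :=
  (Function.Embedding.sectR x Y).trans e

/-- The permutation of `Bool × (Fin k × Fin d)` which exchanges the two copies of the block `j`. -/
def swapBlock {k d : ℕ} (j : Fin k) : Equiv.Perm (Bool × (Fin k × Fin d)) where
  toFun q := (if q.2.1 = j then !q.1 else q.1, q.2)
  invFun q := (if q.2.1 = j then !q.1 else q.1, q.2)
  left_inv q := by rcases q with ⟨x, i, r⟩; by_cases h : i = j <;> simp [h]
  right_inv q := by rcases q with ⟨x, i, r⟩; by_cases h : i = j <;> simp [h]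

theorem map_half_swapBlock_self {k d : ℕ} {α : Type*} (j : Fin k)
    (e : Bool × (Fin k × Fin d) ↪ α) (x : Bool) :
    (block j).map (half ((swapBlock j).toEmbedding.trans e) x) = (block j).map (half e !x) := by
  ext a
  simp [block, half, swapBlock]

theorem map_half_swapBlock_of_ne {k d : ℕ} {α : Type*} {j l : Fin k} (h : l ≠ j)
    (e : Bool × (Fin k × Fin d) ↪ α) (x : Bool) :
    (block l).map (half ((swapBlock j).toEmbedding.trans e) x) = (block l).map (half e x) := by
  ext a
  simp [block, half, swapBlock, h]

theorem sum_block_sub_sq_le {k d : ℕ} {α : Type*} [Fintype α] (b : Finset (Finset α)) :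
    ∑ e : Bool × (Fin k × Fin d) ↪ α,
        (∑ j, (hit b (half e false) (block j) - hit b (half e true) (block j))) ^ 2 ≤
      ∑ e : Bool × (Fin k × Fin d) ↪ α,
        ∑ j, (hit b (half e false) (block j) + hit b (half e true) (block j)) := by
  set Z : Fin k → (Bool × (Fin k × Fin d) ↪ α) → ℝ := fun j e =>
    hit b (half e false) (block j) - hit b (half e true) (block j) with hZ
  have horth (j l : Fin k) (h : l ≠ j) : ∑ e, Z j e * Z l e = 0 := by
    have h1 := Equiv.sum_comp (Equiv.embeddingCongr (swapBlock (d := d) j).symm (Equiv.refl α))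
      fun e => Z j e * Z l e
    have h2 (e : Bool × (Fin k × Fin d) ↪ α) :
        Equiv.embeddingCongr (swapBlock (d := d) j).symm (Equiv.refl α) e =
          (swapBlock j).toEmbedding.trans e := by
      ext q
      rfl
    have h3 (e : Bool × (Fin k × Fin d) ↪ α) :
        Z j ((swapBlock j).toEmbedding.trans e) * Z l ((swapBlock j).toEmbedding.trans e) =
          -(Z j e * Z l e) := by
      simp only [hZ, hit, map_half_swapBlock_self, map_half_swapBlock_of_ne h, Bool.not_true,
        Bool.not_false]
      ring
    simp only [h2, h3, Finset.sum_neg_distrib] at h1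
    linarith
  calc ∑ e, (∑ j, Z j e) ^ 2 = ∑ j, ∑ l, ∑ e, Z j e * Z l e := by
        simp only [sq, Finset.sum_mul_sum]
        rw [Finset.sum_comm]
        exact Finset.sum_congr rfl fun j _ => Finset.sum_comm
    _ = ∑ j, ∑ e, Z j e * Z j e := by
        refine Finset.sum_congr rfl fun j _ => ?_
        exact Finset.sum_eq_single j (fun l _ h => horth j l h) (by simp)
    _ ≤ _ := by
        rw [Finset.sum_comm]
        refine Finset.sum_le_sum fun e _ => Finset.sum_le_sum fun j _ => ?_
        simp only [hZ, hit]
        split_ifs <;> norm_num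

/-- If of every two disjoint sets of size `k * d` one contains at most `T` members of the family
`b` of `d`-sets, then the density of `b` is nearly bounded by the density `T / C(kd, d)`. -/
theorem density_le_of_disjoint {α : Type*} [Fintype α] {k d : ℕ} (hk : 0 < k)
    (hα : 2 * (k * d) ≤ Fintype.card α) (hd : 0 < d) {b : Finset (Finset α)}
    (hb : ∀ D ∈ b, D.card = d) {T t : ℝ} (ht : 0 < t)
    (hT : ∀ S S' : Finset α, S.card = k * d → S'.card = k * d → Disjoint S S' →
      ((b.filter (· ⊆ S)).card : ℝ) ≤ T ∨ ((b.filter (· ⊆ S')).card : ℝ) ≤ T) :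
    (b.card / (Fintype.card α).choose d : ℝ) * (1 - 1 / (2 * t)) ≤
      T / (k * d).choose d + t / (4 * k) := by
  let Y := Fin k × Fin d
  have hY : Fintype.card Y = k * d := by simp [Y]
  let side (e : Bool × Y ↪ α) : Bool :=
    if ((b.filter (· ⊆ Finset.univ.map (half e false))).card : ℝ) ≤ T then false else true
  have hside (e : Bool × Y ↪ α) :
      ((b.filter (· ⊆ Finset.univ.map (half e (side e)))).card : ℝ) ≤ T := by
    by_cases h : ((b.filter (· ⊆ Finset.univ.map (half e false))).card : ℝ) ≤ T
    · simp [side, h]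
    · simp only [side, h, if_false]
      refine (hT _ _ (by simp [hY]) (by simp [hY]) ?_).resolve_left h
      rw [Finset.disjoint_left]
      simp [half]
  have hcount (e : Bool × Y ↪ α) (x : Bool) :
      ∑ F ∈ Finset.powersetCard d Finset.univ, hit b (half e x) F =
        (b.filter (· ⊆ Finset.univ.map (half e x))).card := by
    have : b.filter (· ⊆ Finset.univ.map (half e x)) =
        (Finset.powersetCard d (Finset.univ.map (half e x))).filter (· ∈ b) := by
      ext D
      simp only [Finset.mem_filter, Finset.mem_powersetCard]
      exact ⟨fun h => ⟨⟨h.2, hb D h.1⟩, h.1⟩, fun h => ⟨h.2, h.1.1⟩⟩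
    rw [this, Finset.powersetCard_map, Finset.card_filter, Finset.sum_map]
    push_cast
    rfl
  have hblock (j : Fin k) : (block j : Finset Y).card = d := by simp [block]
  let f (F : Finset Y) : ℝ := ∑ e : Bool × Y ↪ α, hit b (half e (side e)) F
  have hf (π : Equiv.Perm Y) (F : Finset Y) : f (F.map π.toEmbedding) = f F := by
    have h1 := Equiv.sum_comp
      (Equiv.embeddingCongr (Equiv.prodCongr (Equiv.refl Bool) π.symm) (Equiv.refl α))
      fun e => hit b (half e (side e)) F
    change _ = ∑ e, _
    rw [← h1]
    refine Finset.sum_congr rfl fun e _ => ?_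
    set e' := Equiv.embeddingCongr (Equiv.prodCongr (Equiv.refl Bool) π.symm) (Equiv.refl α) e
    have h2 (x : Bool) (F : Finset Y) :
        F.map (half e' x) = (F.map π.toEmbedding).map (half e x) := by
      rw [Finset.map_map]
      congr 1
    have h3 : side e' = side e := by
      simp only [side, h2, Finset.map_univ_equiv]
    simp only [hit, h2, h3]
  have hE : 0 < (Fintype.card (Bool × Y ↪ α) : ℝ) := by
    have : Nonempty (Bool × Y ↪ α) := by
      apply Function.Embedding.nonempty_of_card_le
      simpa [hY] using hα
    exact_mod_cast Fintype.card_pos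
  have hC : 0 < ((k * d).choose d : ℝ) := by
    exact_mod_cast Nat.choose_pos (Nat.le_mul_of_pos_left d hk)
  have hC' : 0 < ((Fintype.card α).choose d : ℝ) := by
    exact_mod_cast Nat.choose_pos (by nlinarith)
  have hfT (j : Fin k) : (k * d).choose d * f (block j) ≤ Fintype.card (Bool × Y ↪ α) * T := by
    have h1 := sum_powersetCard_eq_of_perm_invariant hf
      (b := Finset.powersetCard d Finset.univ) (block j) (by simp [hblock])
    rw [Finset.card_powersetCard, Finset.card_univ, hY] at h1
    rw [← h1, Finset.sum_comm]
    refine (Finset.sum_le_sum fun e _ => (hcount e _).trans_le (hside e)).trans ?_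
    simp
  set ν : ℝ := b.card / (Fintype.card α).choose d with hν
  have hN (x : Bool) (j : Fin k) : ∑ e : Bool × Y ↪ α, hit b (half e x) (block j) =
      ν * Fintype.card (Bool × Y ↪ α) := by
    have h1 := sum_hit_mul_choose (b := b)
      ((block j : Finset Y).map (Function.Embedding.sectR x Y)) (by simpa [hblock] using hb)
    rw [Finset.card_map, hblock] at h1
    have h2 (e : Bool × Y ↪ α) : hit b (half e x) (block j) =
        hit b e ((block j : Finset Y).map (Function.Embedding.sectR x Y)) := by
      rw [hit, hit, Finset.map_map]
      rfl
    simp only [h2, hν]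
    field_simp
    exact h1
  have hpoint (e : Bool × Y ↪ α) :
      (∑ j, (hit b (half e false) (block j) + hit b (half e true) (block j))) -
        ((∑ j, (hit b (half e false) (block j) - hit b (half e true) (block j))) ^ 2 / t + t) / 2 ≤
      2 * ∑ j, hit b (half e (side e)) (block j) := by
    rw [Finset.sum_add_distrib, Finset.sum_sub_distrib]
    have habs (w : ℝ) : |w| ≤ (w ^ 2 / t + t) / 2 := by
      rw [← sq_abs w]
      have : 0 ≤ (|w| - t) ^ 2 / t := by positivity
      have h2 : (|w| - t) ^ 2 / t = |w| ^ 2 / t + t - 2 * |w| := by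
        field_simp
        ring
      linarith
    set A₀ := ∑ j, hit b (half e false) (block j)
    set A₁ := ∑ j, hit b (half e true) (block j)
    have h1 := habs (A₀ - A₁)
    have h2 := le_abs_self (A₀ - A₁)
    have h3 := neg_abs_le (A₀ - A₁)
    cases side e
    · change _ ≤ 2 * A₀
      linarith
    · change _ ≤ 2 * A₁
      linarith
  have hsum := Finset.sum_le_sum fun e (_ : e ∈ Finset.univ) => hpoint e
  have hsq := sum_block_sub_sq_le (k := k) (d := d) b
  have hW : ∑ e : Bool × Y ↪ α,
      ∑ j, (hit b (half e false) (block j) + hit b (half e true) (block j)) =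
        2 * k * (ν * Fintype.card (Bool × Y ↪ α)) := by
    rw [Finset.sum_comm]
    simp only [Finset.sum_add_distrib, hN]
    simp
    ring
  have hfsum : ∑ e : Bool × Y ↪ α, 2 * ∑ j, hit b (half e (side e)) (block j) =
      2 * ∑ j, f (block j) := by
    rw [← Finset.mul_sum, Finset.sum_comm]
  have hfle : ∑ j, f (block j) ≤
      k * (Fintype.card (Bool × Y ↪ α) * T / (k * d).choose d) := by
    refine (Finset.sum_le_sum fun j _ => (le_div_iff₀' hC).mpr (hfT j)).trans ?_
    simp
  have hk' : (0 : ℝ) < k := by exact_mod_cast hk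
  rw [Finset.sum_sub_distrib, hfsum, hW, ← Finset.sum_div, Finset.sum_add_distrib,
    ← Finset.sum_div] at hsum
  rw [hW] at hsq
  set E : ℝ := (Fintype.card (Bool × Y ↪ α) : ℝ) with hEdef
  have hsq' := div_le_div_of_nonneg_right hsq ht.le
  have hconst : ∑ _e : Bool × Y ↪ α, t = E * t := by simp [hEdef]
  rw [hconst] at hsum
  have key : 2 * k * (ν * E) - (2 * k * (ν * E) / t + E * t) / 2 ≤
      2 * (k * (E * T / (k * d).choose d)) := by
    have := hsum.trans (mul_le_mul_of_nonneg_left hfle zero_le_two)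
    linarith
  have : 2 * k * E * (ν * (1 - 1 / (2 * t)) - t / (4 * k)) ≤ 2 * k * E * (T / (k * d).choose d) := by
    convert key using 1
    · field_simp
      ring
    · field_simp
  linarith [le_of_mul_le_mul_left this (by positivity)]

theorem sq_add_le_two_pow (d : ℕ) (hd : 1 ≤ d) : d ^ 2 + d ≤ 2 ^ (d + 1) := by
  induction d, hd using Nat.le_induction with
  | base => norm_num
  | succ d hd ih =>
    rcases Nat.lt_or_ge d 2 with h | h
    · interval_cases d
      norm_num
    · rw [pow_succ 2 (d + 1)]
      nlinarith

theorem mul_density_le {n k d : ℕ} {ν : ℝ} (hν : 0 ≤ ν) (hn : 12 * 2 ^ (d + 2) * (d + 1) ≤ n)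
    (hk : 0 < k) (hkn : n ≤ 2 * (d + 1) * (k + 1))
    (h : ν * (1 - 1 / (2 * (d + 1))) ≤ 2 ^ (d + 1) * d / (k * (d + 1)) + (d + 1) / (4 * k)) :
    n * ν ≤ 2 ^ (d + 2) * (d + 1) := by
  have hpow : ((d : ℝ) + 1) ^ 2 + (d + 1) ≤ 2 ^ (d + 2) := by
    exact_mod_cast sq_add_le_two_pow (d + 1) (by omega)
  have hk' : (0 : ℝ) < k := by exact_mod_cast hk
  have hn' : (12 * 2 ^ (d + 2) * (d + 1) : ℝ) ≤ n := by exact_mod_cast hn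
  have hkn' : (n : ℝ) ≤ 2 * (d + 1) * (k + 1) := by exact_mod_cast hkn
  have h1 : ν * (2 * (d + 1) - 1) * k ≤ 2 ^ (d + 2) * d + (d + 1) ^ 2 / 2 := by
    have h2 := mul_le_mul_of_nonneg_right h (by positivity : (0 : ℝ) ≤ 2 * (d + 1) * k)
    have h3 : ν * (1 - 1 / (2 * (d + 1))) * (2 * (d + 1) * k) = ν * (2 * (d + 1) - 1) * k := by
      field_simp
    have h4 : ((2 : ℝ) ^ (d + 1) * d / (k * (d + 1)) + (d + 1) / (4 * k)) * (2 * (d + 1) * k) =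
        2 ^ (d + 2) * d + (d + 1) ^ 2 / 2 := by
      field_simp
      ring
    rwa [h3, h4] at h2
  have hd : (0 : ℝ) ≤ d := d.cast_nonneg
  set P : ℝ := 2 ^ (d + 2)
  have h3 : ν * (2 * (d + 1) - 1) * (n - 2 * (d + 1)) ≤
      2 * (d + 1) * (P * d + (d + 1) ^ 2 / 2) := by
    have h4 : 0 ≤ ν * (2 * (d + 1) - 1) := mul_nonneg hν (by linarith)
    have h5 := mul_le_mul_of_nonneg_left
      (show (n : ℝ) - 2 * (d + 1) ≤ 2 * (d + 1) * k by linarith) h4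
    have h6 := mul_le_mul_of_nonneg_left h1 (by positivity : (0 : ℝ) ≤ 2 * (d + 1))
    linarith
  by_contra! hcon
  have h7 : P * (d + 1) - (d + 1) / 6 ≤ ν * (n - 2 * (d + 1)) := by
    have hP : 0 < P := by positivity
    have h8 : 12 * P * (ν * (2 * (d + 1))) ≤ 2 * (n * ν) := by nlinarith
    have h9 : n * ν * (12 * P - 2) ≤ 12 * P * (ν * (n - 2 * (d + 1))) := by linarith
    have h10 : P * (d + 1) * (12 * P - 2) ≤ n * ν * (12 * P - 2) :=
      mul_le_mul_of_nonneg_right hcon.le (by nlinarith)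
    have h11 : 12 * P * (P * (d + 1) - (d + 1) / 6) ≤ 12 * P * (ν * (n - 2 * (d + 1))) := by
      linarith
    exact le_of_mul_le_mul_left h11 (by positivity)
  have h12 := mul_le_mul_of_nonneg_right h7 (show (0 : ℝ) ≤ 2 * (d + 1) - 1 by linarith)
  have h13 : (d + 1) * ((d + 1) * 2 - 1) / 6 + (d + 1) ^ 3 < P * (d + 1) := by
    have : ((d + 1) * 2 - 1) / 6 + (d + 1) ^ 2 < P := by linarith
    have := mul_lt_mul_of_pos_right this (by positivity : (0 : ℝ) < d + 1)
    linarith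
  linarith

/-- The inductive step: the bound for sets of size `d + 1` implies the bound for the sets of size
`d + 2` which contain a given qubit `i`. -/
theorem card_not_hasProduct_insert_le {ι : Type*} [DecidableEq ι] [Fintype ι] {d : ℕ}
    (ih : ∀ {y : (ι → Fin 2) → ℂ}, y ≠ 0 → ∀ S : Finset ι, 12 * 2 ^ (d + 1) * d ≤ S.card →
      (S.card : ℝ) * ((S.powersetCard (d + 1)).filter (¬HasProduct · y)).card ≤
        2 ^ (d + 1) * d * S.card.choose (d + 1))
    {ψ : (ι → Fin 2) → ℂ} (hψ : ψ ≠ 0) {V : Finset ι} {i : ι} (hi : i ∈ V)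
    (hV : 12 * 2 ^ (d + 2) * (d + 1) ≤ V.card) :
    (V.card : ℝ) * ((V.powersetCard (d + 2)).filter fun C => ¬HasProduct C ψ ∧ i ∈ C).card ≤
      2 ^ (d + 2) * (d + 1) * (V.card - 1).choose (d + 1) := by
  let α := {x // x ∈ V.erase i}
  let emb : α ↪ ι := Function.Embedding.subtype _
  have hα : Fintype.card α = V.card - 1 := by
    rw [Fintype.card_coe, Finset.card_erase_of_mem hi]
  have hnotin (S : Finset α) : i ∉ S.map emb := by
    rw [Finset.mem_map]
    rintro ⟨x, -, hx⟩
    exact Finset.ne_of_mem_erase x.2 hx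
  let b : Finset (Finset α) := (Finset.powersetCard (d + 1) Finset.univ).filter
    fun D => ¬HasProduct (insert i (D.map emb)) ψ
  have hb (D) (hD : D ∈ b) : D.card = d + 1 := by
    simp only [b, Finset.mem_filter, Finset.mem_powersetCard] at hD
    exact hD.1.2
  have hcard : ((V.powersetCard (d + 2)).filter fun C => ¬HasProduct C ψ ∧ i ∈ C).card ≤
      b.card := by
    refine (Finset.card_le_card fun C hC => ?_).trans
      (Finset.card_image_le (s := b) (f := fun D => insert i (D.map emb)))
    simp only [Finset.mem_filter, Finset.mem_powersetCard] at hC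
    obtain ⟨⟨hCV, hCcard⟩, hCψ, hiC⟩ := hC
    have hmap : ((C.erase i).subtype (· ∈ V.erase i)).map emb = C.erase i :=
      Finset.subtype_map_of_mem fun x hx => Finset.erase_subset_erase i hCV hx
    have hins : insert i (((C.erase i).subtype (· ∈ V.erase i)).map emb) = C := by
      rw [hmap, Finset.insert_erase hiC]
    refine Finset.mem_image.mpr ⟨(C.erase i).subtype (· ∈ V.erase i), ?_, hins⟩
    simp only [b, Finset.mem_filter, Finset.mem_powersetCard, Finset.subset_univ, true_and]
    refine ⟨?_, by rwa [hins]⟩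
    rw [← Finset.card_map emb, hmap, Finset.card_erase_of_mem hiC, hCcard]
    rfl
  have h2 : 4 ≤ 2 ^ (d + 2) := by
    rw [pow_add]
    have := Nat.one_le_two_pow (n := d)
    omega
  set n := V.card
  have hnd : 48 * (d + 1) ≤ n := by nlinarith
  set k := (n - 1) / (2 * (d + 1)) with hkdef
  have hk : 0 < k := Nat.div_pos (by omega) (by omega)
  have hkle : 2 * (k * (d + 1)) ≤ n - 1 := by
    have := Nat.div_mul_le_self (n - 1) (2 * (d + 1))
    rw [← hkdef] at this
    linarith
  have hkn : n ≤ 2 * (d + 1) * (k + 1) := by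
    have := Nat.lt_mul_div_succ (n - 1) (show 0 < 2 * (d + 1) by omega)
    rw [← hkdef] at this
    omega
  have hM : 12 * 2 ^ (d + 1) * d ≤ k * (d + 1) := by
    have h3 : 2 ^ (d + 2) = 2 * 2 ^ (d + 1) := by ring
    rw [h3] at hV
    have := Nat.lt_two_pow_self (n := d)
    have h4 : 2 ^ (d + 1) = 2 * 2 ^ d := by ring
    nlinarith
  have hMpos : (0 : ℝ) < (k * (d + 1) : ℕ) := by exact_mod_cast Nat.mul_pos hk d.succ_pos
  have hCpos : (0 : ℝ) < ((k * (d + 1)).choose (d + 1) : ℕ) := by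
    exact_mod_cast Nat.choose_pos (Nat.le_mul_of_pos_left _ hk)
  have hCpos' : (0 : ℝ) < ((n - 1).choose (d + 1) : ℕ) := by
    exact_mod_cast Nat.choose_pos (by omega)
  have hside (S : Finset α) (hS : S.card = k * (d + 1)) {y : (ι → Fin 2) → ℂ} (hy : y ≠ 0)
      (hsplit : SplitsAs i (S.map emb) ψ y) : ((b.filter (· ⊆ S)).card : ℝ) ≤
        2 ^ (d + 1) * d * (k * (d + 1)).choose (d + 1) / (k * (d + 1) : ℕ) := by
    have h3 := ih hy (S.map emb) (by simpa [hS] using hM)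
    rw [Finset.card_map, hS, ← le_div_iff₀' hMpos] at h3
    refine le_trans ?_ h3
    norm_cast
    refine Finset.card_le_card_of_injOn (fun D => D.map emb) (fun D hD => ?_)
      ((Finset.map_injective emb).injOn)
    simp only [b, Finset.coe_filter, Finset.mem_filter, Finset.mem_powersetCard,
      Set.mem_ofPred_eq] at hD ⊢
    refine ⟨⟨Finset.map_subset_map.mpr hD.2, by simpa using hD.1.1.2⟩, fun hprod => hD.1.2 ?_⟩
    exact hsplit.hasProduct_insert (hnotin S) (Finset.map_subset_map.mpr hD.2) hprod
  have ht : (0 : ℝ) < (d + 1 : ℕ) := by exact_mod_cast d.succ_pos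
  have hdens := density_le_of_disjoint (α := α) hk (hkle.trans_eq hα.symm) d.succ_pos hb
    ht fun S S' hS hS' hdisj => by
      rcases exists_splitsAs_of_disjoint hψ (i := i) (S := S.map emb) (S' := S'.map emb)
        (hnotin S) (hnotin S') ((Finset.disjoint_map emb).mpr hdisj) with
        ⟨y, hy, hs⟩ | ⟨y, hy, hs⟩
      · exact Or.inl (by convert hside S hS hy hs)
      · exact Or.inr (by convert hside S' hS' hy hs)
  rw [hα] at hdens
  have hnum := mul_density_le (n := n) (ν := b.card / (n - 1).choose (d + 1)) (by positivity)
    hV hk hkn (by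
      convert hdens using 1
      · push_cast
        rfl
      · push_cast
        field_simp)
  rw [← mul_div_assoc, div_le_iff₀ hCpos'] at hnum
  refine le_trans ?_ hnum
  gcongr

/-- For at most a fraction `2 ^ (d + 1) * d / |V|` of the subsets of `V` of size `d + 1`, the reduced
support contains no nonzero product vector. -/
theorem card_not_hasProduct_le {ι : Type*} [DecidableEq ι] [Fintype ι] (d : ℕ)
    {ψ : (ι → Fin 2) → ℂ} (hψ : ψ ≠ 0) (V : Finset ι) (hV : 12 * 2 ^ (d + 1) * d ≤ V.card) :
    (V.card : ℝ) * ((V.powersetCard (d + 1)).filter (¬HasProduct · ψ)).card ≤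
      2 ^ (d + 1) * d * V.card.choose (d + 1) := by
  induction d generalizing ψ V with
  | zero =>
    have : (V.powersetCard (0 + 1)).filter (¬HasProduct · ψ) = ∅ := by
      refine Finset.filter_eq_empty_iff.mpr fun C hC => not_not.mpr ?_
      obtain ⟨i, rfl⟩ := Finset.card_eq_one.mp (Finset.mem_powersetCard.mp hC).2
      obtain ⟨y, hy, hs⟩ : ∃ y, y ≠ 0 ∧ SplitsAs i ∅ ψ y := by
        simpa using exists_splitsAs_of_disjoint hψ (i := i) (Finset.notMem_empty i)
          (Finset.notMem_empty i) (Finset.disjoint_empty_left ∅)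
      rw [← insert_empty_eq i]
      exact hs.hasProduct_insert (Finset.notMem_empty i) subset_rfl (hasProduct_empty hy)
    simp [this]
  | succ d ih =>
    have hVpos : 0 < V.card := lt_of_lt_of_le (by positivity) hV
    have hcount : ∑ i ∈ V, ((V.powersetCard (d + 2)).filter
        fun C => ¬HasProduct C ψ ∧ i ∈ C).card =
          ((V.powersetCard (d + 2)).filter (¬HasProduct · ψ)).card * (d + 2) := by
      have hbelow (C) (hC : C ∈ (V.powersetCard (d + 2)).filter (¬HasProduct · ψ)) :
          (V.filter (· ∈ C)).card = d + 2 := by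
        have hCV := Finset.mem_powersetCard.mp (Finset.mem_filter.mp hC).1
        rw [Finset.filter_mem_eq_inter, Finset.inter_eq_right.mpr hCV.1, hCV.2]
      rw [← smul_eq_mul, ← Finset.sum_const, ← Finset.sum_congr rfl hbelow]
      refine Eq.trans (Finset.sum_congr rfl fun i _ => ?_)
        (Finset.sum_card_bipartiteAbove_eq_sum_card_bipartiteBelow fun i C => i ∈ C)
      rw [Finset.bipartiteAbove, Finset.filter_filter]
    have hsum := Finset.sum_le_sum fun i (hi : i ∈ V) =>
      card_not_hasProduct_insert_le ih hψ hi hV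
    rw [← Finset.mul_sum, ← Nat.cast_sum, hcount, Finset.sum_const, nsmul_eq_mul] at hsum
    have hchoose : ((V.card : ℕ) : ℝ) * (V.card - 1).choose (d + 1) =
        V.card.choose (d + 2) * (d + 2 : ℕ) := by
      have := Nat.add_one_mul_choose_eq (V.card - 1) (d + 1)
      rw [Nat.sub_add_cancel hVpos] at this
      exact_mod_cast this
    have hd : (0 : ℝ) < (d + 2 : ℕ) := by positivity
    refine le_of_mul_le_mul_right ?_ hd
    push_cast at hsum hchoose ⊢
    linear_combination hsum + 2 ^ (d + 2) * ((d : ℝ) + 1) * hchoose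

theorem HasProduct.containsProdVec {n : ℕ} {C : Finset (Fin n)} {ψ : (Fin n → Fin 2) → ℂ}
    (h : HasProduct C ψ) : ContainsProdVec C (reducedSupp C ψ) := by
  obtain ⟨φ, hφ, hmem⟩ := h
  refine ⟨fun i => φ i, fun i => hφ i, ?_⟩
  let restrict : ((Fin n → Fin 2) → ℂ) →ₗ[ℂ] QVec n C :=
    LinearMap.funLeft ℂ ℂ fun f : ↥C → Fin 2 => merge C f 0
  have hle : (sliceSpan C ψ).map restrict ≤ reducedSupp C ψ := by
    rw [sliceSpan, Submodule.map_span_le]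
    rintro _ ⟨g, rfl⟩
    refine Submodule.subset_span ⟨fun i => g i, funext fun f => ?_⟩
    change ψ _ = ψ _
    congr 1
    funext i
    by_cases hi : i ∈ C <;> simp [merge, hi]
  convert hle (Submodule.mem_map_of_mem hmem) using 1
  funext f
  change ∏ i : ↥C, φ i (f i) = ∏ i ∈ C, φ i (merge C f 0 i)
  rw [← Finset.prod_coe_sort C fun i => φ i (merge C f 0 i)]
  refine Finset.prod_congr rfl fun i _ => ?_
  simp [merge]

theorem mul_lt_sub_of_psi_lt {n c : ℕ} {p : ℝ} (hc : 3 ≤ c) (hp0 : 0 < p) (hp1 : p < 1)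
    (hn : Psi p c < n) : n * p < n - 2 ^ c * (c - 1) := by
  obtain ⟨⟨hn1, -⟩, hn2⟩ := by simpa only [Psi, max_lt_iff] using hn
  have hq : (8 : ℝ) ≤ 2 ^ c := by
    calc (8 : ℝ) = 2 ^ 3 := by norm_num
      _ ≤ 2 ^ c := pow_le_pow_right₀ (by norm_num) hc
  have hm : (2 : ℝ) ≤ (c : ℝ) - 1 := by
    have : (3 : ℝ) ≤ c := by exact_mod_cast hc
    linarith
  have hlog : (1.386 : ℝ) < Real.log 4 := by
    have h : Real.log 4 = 2 * Real.log 2 := by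
      rw [show (4 : ℝ) = 2 ^ 2 by norm_num, Real.log_pow]
      norm_num
    linarith [Real.log_two_gt_d9]
  have hL : Real.log (1 / p) = -Real.log p := by simp
  have hLpos : 0 < -Real.log p := neg_pos.mpr (Real.log_neg hp0 hp1)
  rw [hL] at hn1
  rw [pow_succ] at hn2
  set q : ℝ := 2 ^ c
  set m : ℝ := c - 1
  set a : ℝ := (q - 1) * m * Real.log 4
  have ha : 12 * (q * m) ≤ 11 * a := by
    have h : 12 * q ≤ 11 * ((q - 1) * Real.log 4) := by nlinarith
    have := mul_le_mul_of_nonneg_right h (by linarith : 0 ≤ m)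
    linarith
  have hK : 0 < q * m := by positivity
  have hapos : 0 < a := by linarith
  set n' : ℝ := n - (q - 2)
  have hdiv : 0 < a / -Real.log p := by positivity
  have hn' : a / -Real.log p < n' := by
    simp only [n']
    linarith
  have hn'pos : 0 < n' := hdiv.trans hn'
  have hpx : p * (a / n' + 1) < 1 := by
    have h1 : a / n' < -Real.log p := (div_lt_comm₀ hLpos hn'pos).mp hn'
    have h2 : Real.exp (a / n') < p⁻¹ := by
      rw [← Real.exp_log (inv_pos.mpr hp0), Real.log_inv]
      exact Real.exp_lt_exp.mpr h1
    calc p * (a / n' + 1) ≤ p * Real.exp (a / n') := by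
          gcongr
          exact Real.add_one_le_exp _
      _ < p * p⁻¹ := by gcongr
      _ = 1 := mul_inv_cancel₀ hp0.ne'
  have hpn : p * (n' + a) < n' := by
    have := mul_lt_mul_of_pos_right hpx hn'pos
    rwa [mul_assoc, add_mul, div_mul_cancel₀ _ hn'pos.ne', one_mul, add_comm a n'] at this
  have hmain : q * m * (n' + a) ≤ a * n := by
    have h1 : n' ≤ n := by
      simp only [n']
      linarith
    have h2 := mul_le_mul_of_nonneg_left h1 hK.le
    have h3 : (a - q * m) * (12 * (q * m)) ≤ (a - q * m) * n :=
      mul_le_mul_of_nonneg_left (by linarith) (by linarith)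
    have h4 := mul_le_mul_of_nonneg_left ha hK.le
    linarith
  have hpos : 0 < n' + a := by linarith
  have hnpos : (0 : ℝ) < n := by linarith
  refine lt_of_mul_lt_mul_right ?_ hpos.le
  have := mul_lt_mul_of_pos_left hpn hnpos
  linarith

/-- **Theorem 1 (local satisfiability), state form.**
If `c ≥ 3`, `p ∈ (0,1)` and `n > Ψ(p,c)`, then for any nonzero state
`|ψ⟩ ∈ (ℂ²)^{⊗n}`, the number of `c`-element subsets `C` of the qubits for which the
support of the reduced density matrix of `|ψ⟩` on `C` contains a nonzero product vector is
greater than `p · C(n,c)`. -/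
theorem reduced_support_contains_product
    (n c : ℕ) (p : ℝ) (hc : 3 ≤ c) (hp0 : 0 < p) (hp1 : p < 1)
    (hn : Psi p c < (n : ℝ)) (ψ : (Fin n → Fin 2) → ℂ) (hψ : ψ ≠ 0) :
    p * (n.choose c : ℝ) <
      (((Finset.powersetCard c (Finset.univ : Finset (Fin n))).filter
        (fun C => ContainsProdVec C (reducedSupp C ψ))).card : ℝ) := by
  have hnum := mul_lt_sub_of_psi_lt hc hp0 hp1 hn
  have hn2 : 6 * (2 : ℝ) ^ (c + 1) * (c - 1) < n := (le_max_right _ _).trans_lt hn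
  obtain ⟨d, rfl⟩ := Nat.exists_eq_add_of_le' (show 1 ≤ c by omega)
  have hnd : 12 * 2 ^ (d + 1) * d ≤ n := by
    have : (12 * 2 ^ (d + 1) * d : ℝ) ≤ n := by
      push_cast at hn2
      rw [pow_succ] at hn2
      linarith
    exact_mod_cast this
  have hdn : d + 1 ≤ n := by
    have := Nat.one_le_two_pow (n := d + 1)
    nlinarith
  have hCpos : (0 : ℝ) < n.choose (d + 1) := by exact_mod_cast Nat.choose_pos hdn
  have hbad := card_not_hasProduct_le d hψ Finset.univ (by simpa using hnd)
  rw [Finset.card_univ, Fintype.card_fin] at hbad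
  have hsplit := Finset.card_filter_add_card_filter_not
    (s := Finset.powersetCard (d + 1) (Finset.univ : Finset (Fin n))) (HasProduct · ψ)
  rw [Finset.card_powersetCard, Finset.card_univ, Fintype.card_fin] at hsplit
  have hgood : ((Finset.powersetCard (d + 1) (Finset.univ : Finset (Fin n))).filter
      (HasProduct · ψ)).card ≤ ((Finset.powersetCard (d + 1) (Finset.univ : Finset (Fin n))).filter
        (fun C => ContainsProdVec C (reducedSupp C ψ))).card :=
    Finset.card_le_card (Finset.monotone_filter_right _ fun C _ h => h.containsProdVec)
  refine lt_of_lt_of_le ?_ (Nat.cast_le.mpr hgood)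
  have hsplit' := congrArg (Nat.cast (R := ℝ)) hsplit
  push_cast at hsplit' hnum
  have hnpos : (0 : ℝ) < n := by exact_mod_cast (Nat.succ_pos d).trans_le hdn
  refine lt_of_mul_lt_mul_left ?_ hnpos.le
  have := mul_lt_mul_of_pos_right hnum hCpos
  rw [← hsplit'] at this hbad ⊢
  linarith

end QkSAT
end
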